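/- Let n ≥ 1, let ρ_PQ be a density matrix on P×Q and σ_Q a density matrix on Q such that ρ_PQ ≤ 2^λ·(ρ_P ⊗ σ_Q) for some real λ. Let τ be the convex-split state on P×Q₁×…×Qₙ, let τ_{Q₁…Qₙ} be its marginal on Q₁×…×Qₙ, and let τ_{PQₙ} := (1/n)·ρ_PQ + ((n−1)/n)·ρ_P ⊗ σ_Q (which equals the marginal of τ on P and the n-th copy of Q). Then I(P : Q₁…Qₙ)_τ ≤ D(ρ_{PQₙ} ⊗ σ_{Q₁} ⊗ … ⊗ σ_{Q_{n−1}} ‖ ρ_P ⊗ τ_{Q₁…Qₙ}) − D(ρ_PQ ‖ τ_{PQₙ}), where ρ_{PQₙ} ⊗ σ_{Q₁} ⊗ … ⊗ σ_{Q_{n−1}} denotes the state placing ρ_PQ on P and the n-th copy of Q and σ_Q on each of the other n−1 copies. -/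

import Mathlib

open scoped Kronecker BigOperators
open Matrix
open scoped ComplexOrder Classical

noncomputable section

/-- A density matrix: positive semidefinite with unit trace. -/
def IsDensityMatrix {d : Type*} [Fintype d] (ρ : Matrix d d ℂ) : Prop :=
  ρ.PosSemidef ∧ ρ.trace = 1

/-- Loewner order on Hermitian matrices: `A ≤ B` iff `B - A` is positive semidefinite. -/
def LoewnerLE {d : Type*} [Fintype d] (A B : Matrix d d ℂ) : Prop := (B - A).PosSemidef

/-- Partial trace over the second tensor factor. -/
def ptrace2 {d₁ d₂ : Type*} [Fintype d₂] (M : Matrix (d₁ × d₂) (d₁ × d₂) ℂ) :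
    Matrix d₁ d₁ ℂ :=
  fun i i' => ∑ k, M (i, k) (i', k)

/-- Partial trace over the first tensor factor. -/
def ptrace1 {d₁ d₂ : Type*} [Fintype d₁] (M : Matrix (d₁ × d₂) (d₁ × d₂) ℂ) :
    Matrix d₂ d₂ ℂ :=
  fun j j' => ∑ k, M (k, j) (k, j')

/-- Functional calculus for Hermitian matrices: apply `f` to the eigenvalues. -/
def hermCFC {d : Type*} [Fintype d] [DecidableEq d] (f : ℝ → ℝ) (A : Matrix d d ℂ) :
    Matrix d d ℂ :=
  if hA : A.IsHermitian then
    (hA.eigenvectorUnitary : Matrix d d ℂ) *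
      Matrix.diagonal (fun i => (f (hA.eigenvalues i) : ℂ)) *
      (star (hA.eigenvectorUnitary : Matrix d d ℂ))
  else 0

/-- Matrix logarithm, base 2, applied to nonzero eigenvalues. -/
def matLog2 {d : Type*} [Fintype d] [DecidableEq d] (A : Matrix d d ℂ) : Matrix d d ℂ :=
  hermCFC (Real.logb 2) A

/-- Positive semidefinite square root (via functional calculus). -/
def matSqrt {d : Type*} [Fintype d] [DecidableEq d] (A : Matrix d d ℂ) : Matrix d d ℂ :=
  hermCFC Real.sqrt A

/-- Support containment: the kernel of `σ` is contained in the kernel of `ρ`. -/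
def SupportLE {d : Type*} [Fintype d] (ρ σ : Matrix d d ℂ) : Prop :=
  ∀ v : d → ℂ, σ.mulVec v = 0 → ρ.mulVec v = 0

/-- Relative entropy, base 2, as a real number (meaningful when supports are nested). -/
def relentR {d : Type*} [Fintype d] [DecidableEq d] (ρ σ : Matrix d d ℂ) : ℝ :=
  ((ρ * matLog2 ρ).trace - (ρ * matLog2 σ).trace).re

/-- Relative entropy `D(ρ‖σ)`, base 2, valued in the extended reals: `+∞` unless
the support of `ρ` is contained in the support of `σ`. -/
def relent {d : Type*} [Fintype d] [DecidableEq d] (ρ σ : Matrix d d ℂ) : EReal :=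
  if SupportLE ρ σ then ((relentR ρ σ : ℝ) : EReal) else ⊤

/-- Mutual information `I(A:B)_ρ = D(ρ_AB ‖ ρ_A ⊗ ρ_B)`. -/
def mutInfo {d₁ d₂ : Type*} [Fintype d₁] [Fintype d₂] [DecidableEq d₁] [DecidableEq d₂]
    (ρ : Matrix (d₁ × d₂) (d₁ × d₂) ℂ) : EReal :=
  relent ρ (ptrace2 ρ ⊗ₖ ptrace1 ρ)

/-- Fidelity `F(ρ,σ) = Tr √(√σ ρ √σ)`. -/
def fidelity {d : Type*} [Fintype d] [DecidableEq d] (ρ σ : Matrix d d ℂ) : ℝ :=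
  ((matSqrt (matSqrt σ * ρ * matSqrt σ)).trace).re

/-- Purified distance `P(ρ,σ) = √(1 - F(ρ,σ)²)`. -/
def pdist {d : Type*} [Fintype d] [DecidableEq d] (ρ σ : Matrix d d ℂ) : ℝ :=
  Real.sqrt (1 - (fidelity ρ σ) ^ 2)

/-- Max-relative entropy `Dmax(ρ‖σ) = inf {λ : ρ ≤ 2^λ σ}`, valued in the extended reals. -/
def dmax {d : Type*} [Fintype d] (ρ σ : Matrix d d ℂ) : EReal :=
  sInf {x : EReal | ∃ l : ℝ, x = (l : EReal) ∧ LoewnerLE ρ (((2 : ℝ) ^ l) • σ)}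

/-- Max-information `Imax(A:B)_ρ`. -/
def imax {d₁ d₂ : Type*} [Fintype d₁] [Fintype d₂]
    (ρ : Matrix (d₁ × d₂) (d₁ × d₂) ℂ) : EReal :=
  ⨅ σ : {σ : Matrix d₂ d₂ ℂ // IsDensityMatrix σ}, dmax ρ (ptrace2 ρ ⊗ₖ σ.1)

/-- Smooth max-information `Imax^ε(A:B)_ρ`. -/
def imaxEps {d₁ d₂ : Type*} [Fintype d₁] [Fintype d₂] [DecidableEq d₁] [DecidableEq d₂]
    (ε : ℝ) (ρ : Matrix (d₁ × d₂) (d₁ × d₂) ℂ) : EReal :=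
  ⨅ ρ' : {ρ' : Matrix (d₁ × d₂) (d₁ × d₂) ℂ // IsDensityMatrix ρ' ∧ pdist ρ ρ' ≤ ε},
    imax ρ'.1

/-- The `j`-th term of the convex split: `ρ` on `P` and the `j`-th copy of `Q`, and
`σ` on every other copy of `Q`. -/
def blockState {P Q : Type*} [Fintype Q] [DecidableEq Q]
    (ρ : Matrix (P × Q) (P × Q) ℂ) (σ : Matrix Q Q ℂ) (n : ℕ) (j : Fin n) :
    Matrix (P × (Fin n → Q)) (P × (Fin n → Q)) ℂ :=
  fun x y => ρ (x.1, x.2 j) (y.1, y.2 j) * ∏ i ∈ Finset.univ.erase j, σ (x.2 i) (y.2 i)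

/-- The convex-split state `τ = (1/n) Σ_j ρ_{PQ_j} ⊗ σ_{Q_1} ⊗ ⋯ ⊗ σ_{Q_n}` (omitting `j`). -/
def convexSplit {P Q : Type*} [Fintype Q] [DecidableEq Q]
    (ρ : Matrix (P × Q) (P × Q) ℂ) (σ : Matrix Q Q ℂ) (n : ℕ) :
    Matrix (P × (Fin n → Q)) (P × (Fin n → Q)) ℂ :=
  ((n : ℂ)⁻¹) • ∑ j : Fin n, blockState ρ σ n j

/-- A finite nonempty index type. -/
structure FinIdx where
  carrier : Type
  [fin : Fintype carrier]
  [deq : DecidableEq carrier]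
  [ne : Nonempty carrier]

attribute [instance] FinIdx.fin FinIdx.deq FinIdx.ne

open Filter Topology in
lemma tendsto_sum_mul_log_add_mul {K : Type*} [Fintype K] {c r s : K → ℝ}
    (hr : ∀ k, 0 ≤ r k) (hs : ∀ k, 0 ≤ s k) :
    Tendsto (fun t ↦ ∑ k, c k * r k * Real.log (s k + t * r k) -
      (∑ k, c k * r k) * Real.log t) atTop (𝓝 (∑ k, c k * r k * Real.log (r k))) := by
  simp only [Finset.sum_mul, ← Finset.sum_sub_distrib, ← mul_sub]
  refine tendsto_finsetSum _ fun k _ ↦ ?_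
  rcases (hr k).eq_or_lt with h | h
  · simp [← h]
  · refine Tendsto.const_mul _ ?_
    have h1 : Tendsto (fun t : ℝ ↦ s k * t⁻¹ + r k) atTop (𝓝 (r k)) := by
      simpa using (tendsto_inv_atTop_zero.const_mul (s k)).add_const (r k)
    refine (h1.log h.ne').congr' ?_
    filter_upwards [eventually_gt_atTop 0] with t ht
    have hp : s k + t * r k ≠ 0 := by have := hs k; positivity
    rw [← Real.log_div hp ht.ne']
    congr 1
    field_simp

lemma continuousOn_sum_mul_log_add_mul {K : Type*} [Fintype K] {c r s : K → ℝ}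
    (hr : ∀ k, 0 ≤ r k) (hs : ∀ k, 0 ≤ s k) (h0 : ∀ k, s k = 0 → c k * r k = 0) :
    ContinuousOn (fun t ↦ ∑ k, c k * r k * Real.log (s k + t * r k)) (Set.Ici 0) := by
  refine continuousOn_finsetSum _ fun k _ ↦ ?_
  rcases (hs k).eq_or_lt with h | h
  · simp only [h0 k h.symm, zero_mul]; exact continuousOn_const
  · refine continuousOn_const.mul (ContinuousOn.log (by fun_prop) fun t ht ↦ ?_)
    have := mul_nonneg ht (hr k)
    positivity

lemma hasDerivAt_sum_mul_log_add_mul {K : Type*} [Fintype K] {c r s : K → ℝ}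
    (hr : ∀ k, 0 ≤ r k) (hs : ∀ k, 0 ≤ s k) {t : ℝ} (ht : 0 < t) :
    HasDerivAt (fun t ↦ ∑ k, c k * r k * Real.log (s k + t * r k))
      (∑ k, c k * (r k ^ 2 / (s k + t * r k))) t := by
  refine HasDerivAt.fun_sum fun k _ ↦ ?_
  rcases (hr k).eq_or_lt with h | h
  · simpa [← h] using hasDerivAt_const t (0 : ℝ)
  · have hp : s k + t * r k ≠ 0 := by have := hs k; positivity
    have h1 : HasDerivAt (fun t ↦ s k + t * r k) (r k) t := by
      simpa using ((hasDerivAt_id t).mul_const (r k)).const_add (s k)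
    refine ((h1.log hp).const_mul (c k * r k)).congr_deriv ?_
    field_simp

/-- Integrating over `t` an inequality between weighted sums of `r² / (s + t r)` gives the
inequality between the corresponding weighted sums of `r (log r - log s)`. -/
lemma sum_mul_log_sub_log_le {K K' : Type*} [Fintype K] [Fintype K']
    {c r s : K → ℝ} {c' r' s' : K' → ℝ}
    (hr : ∀ k, 0 ≤ r k) (hs : ∀ k, 0 ≤ s k) (hr' : ∀ k, 0 ≤ r' k) (hs' : ∀ k, 0 ≤ s' k)
    (h0 : ∀ k, s k = 0 → c k * r k = 0) (h0' : ∀ k, s' k = 0 → c' k * r' k = 0)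
    (hsum : ∑ k, c' k * r' k = ∑ k, c k * r k)
    (hres : ∀ t : ℝ, 0 < t →
      ∑ k, c' k * (r' k ^ 2 / (s' k + t * r' k)) ≤ ∑ k, c k * (r k ^ 2 / (s k + t * r k))) :
    ∑ k, c' k * r' k * (Real.log (r' k) - Real.log (s' k)) ≤
      ∑ k, c k * r k * (Real.log (r k) - Real.log (s k)) := by
  have mono : MonotoneOn (fun t ↦ ∑ k, c k * r k * Real.log (s k + t * r k) -
      ∑ k, c' k * r' k * Real.log (s' k + t * r' k)) (Set.Ici 0) := by
    refine monotoneOn_of_deriv_nonneg (convex_Ici 0)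
      ((continuousOn_sum_mul_log_add_mul hr hs h0).sub
        (continuousOn_sum_mul_log_add_mul hr' hs' h0'))
      (fun t ht ↦ ?_) fun t ht ↦ ?_ <;> rw [interior_Ici, Set.mem_Ioi] at ht
    · exact ((hasDerivAt_sum_mul_log_add_mul hr hs ht).sub
        (hasDerivAt_sum_mul_log_add_mul hr' hs' ht)).differentiableAt.differentiableWithinAt
    · rw [((hasDerivAt_sum_mul_log_add_mul hr hs ht).fun_sub
        (hasDerivAt_sum_mul_log_add_mul hr' hs' ht)).deriv]
      exact sub_nonneg.2 (hres t ht)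
  have key := ge_of_tendsto ((tendsto_sum_mul_log_add_mul (c := c) hr hs).sub
      (tendsto_sum_mul_log_add_mul (c := c') hr' hs'))
      (b := ∑ k, c k * r k * Real.log (s k) - ∑ k, c' k * r' k * Real.log (s' k)) <| by
    filter_upwards [Filter.eventually_ge_atTop 0] with t ht
    have := mono (Set.mem_Ici.2 le_rfl) ht ht
    simp only [zero_mul, add_zero] at this
    rw [hsum]
    linarith
  simp only [mul_sub, Finset.sum_sub_distrib]
  linarith

section Spectral

variable {d : Type*} [Fintype d] [DecidableEq d]

lemma Matrix.IsHermitian.eq_eigenvectorUnitary_mul {A : Matrix d d ℂ} (hA : A.IsHermitian) :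
    A = hA.eigenvectorUnitary * diagonal (fun i ↦ (hA.eigenvalues i : ℂ)) *
      star (hA.eigenvectorUnitary : Matrix d d ℂ) := by
  conv_lhs => rw [hA.spectral_theorem]
  rfl

lemma trace_conj_diagonal_mul (U W : Matrix d d ℂ) (r l : d → ℝ) :
    (U * diagonal (fun i ↦ (r i : ℂ)) * star U *
      (W * diagonal (fun j ↦ (l j : ℂ)) * star W)).trace =
      ((∑ i, ∑ j, ‖(star W * U) j i‖ ^ 2 * r i * l j : ℝ) : ℂ) := by
  have h : (U * diagonal (fun i ↦ (r i : ℂ)) * star U *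
      (W * diagonal (fun j ↦ (l j : ℂ)) * star W)).trace =
      (diagonal (fun i ↦ (r i : ℂ)) * (star (star W * U) *
        (diagonal (fun j ↦ (l j : ℂ)) * (star W * U)))).trace := by
    rw [star_mul, star_star]
    simp only [Matrix.mul_assoc]
    rw [trace_mul_comm]
    simp only [Matrix.mul_assoc]
  rw [h]
  simp only [Matrix.trace, diag_apply, diagonal_mul]
  push_cast
  refine Finset.sum_congr rfl fun i _ ↦ ?_
  rw [mul_apply, Finset.mul_sum]
  refine Finset.sum_congr rfl fun j _ ↦ ?_
  rw [diagonal_mul, star_apply, ← Complex.conj_mul']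
  simp only [RCLike.star_def]
  ring

lemma trace_conj_diagonal_mul_self {U : Matrix d d ℂ} (hU : star U * U = 1) (r l : d → ℝ) :
    (U * diagonal (fun i ↦ (r i : ℂ)) * star U *
      (U * diagonal (fun j ↦ (l j : ℂ)) * star U)).trace = ((∑ i, r i * l i : ℝ) : ℂ) := by
  rw [trace_conj_diagonal_mul, hU]
  simp [one_apply, apply_ite, ite_pow]

lemma sum_norm_sq_unitary {G : Matrix d d ℂ} (hG : star G * G = 1) (i : d) :
    ∑ j, ‖G j i‖ ^ 2 = 1 := by
  have h := congrFun (congrFun hG i) i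
  simp only [mul_apply, star_apply, RCLike.star_def, Complex.conj_mul', one_apply_eq] at h
  exact_mod_cast h

/-- The quadratic form whose supremum over `X` is `⟨ρ, (L_σ + t R_ρ)⁻¹ ρ⟩`. -/
def resolventForm (ρ σ : Matrix d d ℂ) (t : ℝ) (X : Matrix d d ℂ) : ℝ :=
  2 * (Xᴴ * ρ).trace.re - (X * Xᴴ * σ).trace.re - t * (Xᴴ * X * ρ).trace.re

lemma resolventForm_conj {U W : Matrix d d ℂ} (hU : star U * U = 1) (hW : star W * W = 1)
    (r s : d → ℝ) (t : ℝ) (Y : Matrix d d ℂ) :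
    resolventForm (U * diagonal (fun i ↦ (r i : ℂ)) * star U)
      (W * diagonal (fun j ↦ (s j : ℂ)) * star W) t (W * Y * star U) =
    ∑ i, ∑ j, (2 * (star (Y j i) * (star W * U) j i).re * r i -
      (s j + t * r i) * ‖Y j i‖ ^ 2) := by
  have hU' (Z : Matrix d d ℂ) : star U * (U * Z) = Z := by
    rw [← Matrix.mul_assoc, hU, Matrix.one_mul]
  have hW' (Z : Matrix d d ℂ) : star W * (W * Z) = Z := by
    rw [← Matrix.mul_assoc, hW, Matrix.one_mul]
  have hconj : (W * Y * star U)ᴴ = U * (Yᴴ * star W) := by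
    simp only [← star_eq_conjTranspose, star_mul, star_star]
  have e1 : ((W * Y * star U)ᴴ * (U * diagonal (fun i ↦ (r i : ℂ)) * star U)).trace.re =
      ∑ i, ∑ j, (star (Y j i) * (star W * U) j i).re * r i := by
    have : ((W * Y * star U)ᴴ * (U * diagonal (fun i ↦ (r i : ℂ)) * star U)).trace =
        (diagonal (fun i ↦ (r i : ℂ)) * (Yᴴ * (star W * U))).trace := by
      rw [hconj, Matrix.mul_assoc, trace_mul_comm, trace_mul_comm (diagonal _)]
      simp only [Matrix.mul_assoc, hU, Matrix.mul_one]
    rw [this]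
    simp only [Matrix.trace, diag_apply, diagonal_mul, mul_apply (M := Yᴴ), Finset.mul_sum,
      Complex.re_sum, conjTranspose_apply, Complex.re_ofReal_mul]
    simp only [mul_comm]
  have e2 : ((W * Y * star U) * (W * Y * star U)ᴴ *
      (W * diagonal (fun j ↦ (s j : ℂ)) * star W)).trace.re =
      ∑ i, ∑ j, s j * ‖Y j i‖ ^ 2 := by
    have : ((W * Y * star U) * (W * Y * star U)ᴴ *
        (W * diagonal (fun j ↦ (s j : ℂ)) * star W)).trace =
        (diagonal (fun j ↦ (s j : ℂ)) * (Y * Yᴴ)).trace := by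
      rw [hconj]
      simp only [Matrix.mul_assoc, hU', hW']
      rw [trace_mul_comm, trace_mul_comm (diagonal _)]
      simp only [Matrix.mul_assoc, hW, Matrix.mul_one]
    rw [this, Finset.sum_comm]
    simp only [Matrix.trace, diag_apply, diagonal_mul, mul_apply (M := Y), Finset.mul_sum,
      Complex.re_sum, conjTranspose_apply, Complex.re_ofReal_mul, RCLike.star_def,
      Complex.mul_conj', ← Complex.ofReal_pow, Complex.ofReal_re]
  have e3 : ((W * Y * star U)ᴴ * (W * Y * star U) *
      (U * diagonal (fun i ↦ (r i : ℂ)) * star U)).trace.re =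
      ∑ i, ∑ j, r i * ‖Y j i‖ ^ 2 := by
    have : ((W * Y * star U)ᴴ * (W * Y * star U) *
        (U * diagonal (fun i ↦ (r i : ℂ)) * star U)).trace =
        (diagonal (fun i ↦ (r i : ℂ)) * (Yᴴ * Y)).trace := by
      rw [hconj]
      simp only [Matrix.mul_assoc, hU', hW']
      rw [trace_mul_comm, trace_mul_comm (diagonal _)]
      simp only [Matrix.mul_assoc, hU, Matrix.mul_one]
    rw [this]
    simp only [Matrix.trace, diag_apply, diagonal_mul, mul_apply (M := Yᴴ), Finset.mul_sum,
      Complex.re_sum, conjTranspose_apply, Complex.re_ofReal_mul, RCLike.star_def,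
      Complex.conj_mul', ← Complex.ofReal_pow, Complex.ofReal_re]
  rw [resolventForm, e1, e2, e3]
  simp only [Finset.mul_sum, ← Finset.sum_sub_distrib]
  refine Finset.sum_congr rfl fun i _ ↦ Finset.sum_congr rfl fun j _ ↦ ?_
  ring

lemma two_mul_re_sub_le {r s t : ℝ} (hr : 0 ≤ r) (hs : 0 ≤ s) (ht : 0 < t) (y g : ℂ) :
    2 * (star y * g).re * r - (s + t * r) * ‖y‖ ^ 2 ≤ ‖g‖ ^ 2 * (r ^ 2 / (s + t * r)) := by
  rcases hr.eq_or_lt with rfl | hr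
  · have := mul_nonneg hs (sq_nonneg ‖y‖)
    simpa using this
  have hp : 0 < s + t * r := by positivity
  have h1 : (star y * g).re ≤ ‖y‖ * ‖g‖ := by
    simpa using Complex.re_le_norm (star y * g)
  have h2 : 2 * (‖y‖ * ‖g‖) * r - (s + t * r) * ‖y‖ ^ 2 ≤ ‖g‖ ^ 2 * (r ^ 2 / (s + t * r)) := by
    rw [mul_div_assoc', le_div_iff₀ hp]
    nlinarith [sq_nonneg ((s + t * r) * ‖y‖ - ‖g‖ * r)]
  nlinarith

lemma resolventForm_le {U W : Matrix d d ℂ} (hU : star U * U = 1) (hW : star W * W = 1)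
    {r s : d → ℝ} (hr : ∀ i, 0 ≤ r i) (hs : ∀ j, 0 ≤ s j) {t : ℝ} (ht : 0 < t)
    (X : Matrix d d ℂ) :
    resolventForm (U * diagonal (fun i ↦ (r i : ℂ)) * star U)
      (W * diagonal (fun j ↦ (s j : ℂ)) * star W) t X ≤
    ∑ i, ∑ j, ‖(star W * U) j i‖ ^ 2 * (r i ^ 2 / (s j + t * r i)) := by
  have hX : X = W * (star W * X * U) * star U := by
    rw [← Matrix.mul_assoc, ← Matrix.mul_assoc, mul_eq_one_comm.1 hW, Matrix.one_mul,
      Matrix.mul_assoc, mul_eq_one_comm.1 hU, Matrix.mul_one]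
  rw [hX, resolventForm_conj hU hW]
  exact Finset.sum_le_sum fun i _ ↦ Finset.sum_le_sum fun j _ ↦
    two_mul_re_sub_le (hr i) (hs j) ht _ _

lemma exists_resolventForm_eq {U W : Matrix d d ℂ} (hU : star U * U = 1) (hW : star W * W = 1)
    {r s : d → ℝ} (hr : ∀ i, 0 ≤ r i) (hs : ∀ j, 0 ≤ s j) {t : ℝ} (ht : 0 < t) :
    ∃ X, resolventForm (U * diagonal (fun i ↦ (r i : ℂ)) * star U)
      (W * diagonal (fun j ↦ (s j : ℂ)) * star W) t X =
    ∑ i, ∑ j, ‖(star W * U) j i‖ ^ 2 * (r i ^ 2 / (s j + t * r i)) := by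
  refine ⟨W * of (fun j i ↦ ((r i / (s j + t * r i) : ℝ) : ℂ) * (star W * U) j i) * star U, ?_⟩
  rw [resolventForm_conj hU hW]
  refine Finset.sum_congr rfl fun i _ ↦ Finset.sum_congr rfl fun j _ ↦ ?_
  rcases (hr i).eq_or_lt with h | h
  · simp [← h]
  have hp : 0 < s j + t * r i := by have := hs j; positivity
  have h1 : (star (((r i / (s j + t * r i) : ℝ) : ℂ) * (star W * U) j i) *
      (star W * U) j i).re = r i / (s j + t * r i) * ‖(star W * U) j i‖ ^ 2 := by
    simp only [star_mul', RCLike.star_def, Complex.conj_ofReal, mul_assoc, Complex.conj_mul',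
      ← Complex.ofReal_pow, ← Complex.ofReal_mul, Complex.ofReal_re]
  rw [of_apply, h1, norm_mul, Complex.norm_real, mul_pow, Real.norm_eq_abs, sq_abs]
  field_simp
  ring

end Spectral

section RelativeEntropy

variable {d : Type*} [Fintype d] [DecidableEq d] {ρ σ : Matrix d d ℂ}

lemma Matrix.IsHermitian.star_eigenvectorUnitary_mul_self (hρ : ρ.IsHermitian) :
    star (hρ.eigenvectorUnitary : Matrix d d ℂ) * (hρ.eigenvectorUnitary : Matrix d d ℂ) = 1 :=
  Unitary.coe_star_mul_self hρ.eigenvectorUnitary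

/-- The squared overlap of the `k.1`-th eigenvector of `ρ` with the `k.2`-th eigenvector
of `σ`. -/
def eigenOverlap (hρ : ρ.IsHermitian) (hσ : σ.IsHermitian) (k : d × d) : ℝ :=
  ‖(star (hσ.eigenvectorUnitary : Matrix d d ℂ) *
    (hρ.eigenvectorUnitary : Matrix d d ℂ)) k.2 k.1‖ ^ 2

lemma SupportLE.eigenOverlap_mul_eq_zero (h : SupportLE ρ σ)
    (hρ : ρ.IsHermitian) (hσ : σ.IsHermitian) (k : d × d) (hk : hσ.eigenvalues k.2 = 0) :
    eigenOverlap hρ hσ k * hρ.eigenvalues k.1 = 0 := by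
  obtain ⟨i, j⟩ := k
  rw [eigenOverlap]
  have hU := hρ.star_eigenvectorUnitary_mul_self
  set U := (hρ.eigenvectorUnitary : Matrix d d ℂ) with hUdef
  set W := (hσ.eigenvectorUnitary : Matrix d d ℂ) with hWdef
  have h1 : ρ *ᵥ (W *ᵥ Pi.single j 1) = 0 := by
    refine h _ ?_
    rw [hWdef, hσ.eigenvectorUnitary_mulVec, hσ.mulVec_eigenvectorBasis, hk, zero_smul]
  have h2 : star U * ρ * W = diagonal (fun i ↦ (hρ.eigenvalues i : ℂ)) * (star (star W * U)) := by
    conv_lhs => rw [hρ.eq_eigenvectorUnitary_mul, ← hUdef]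
    simp only [← Matrix.mul_assoc, hU, Matrix.one_mul, star_mul, star_star]
  have h3 : (star U * ρ * W) i j = 0 := by
    have : (star U * ρ * W) *ᵥ Pi.single j 1 = 0 := by
      rw [← mulVec_mulVec, ← mulVec_mulVec, h1, mulVec_zero]
    simpa [mulVec_single_one] using congrFun this i
  rw [h2, diagonal_mul, mul_eq_zero] at h3
  rcases h3 with h3 | h3
  · rw [Complex.ofReal_eq_zero.1 h3, mul_zero]
  · rw [star_apply, star_eq_zero] at h3
    rw [h3]; simp

lemma sum_eigenOverlap (hρ : ρ.IsHermitian) (hσ : σ.IsHermitian) (i : d) :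
    ∑ j, eigenOverlap hρ hσ (i, j) = 1 := by
  refine sum_norm_sq_unitary (G := star (hσ.eigenvectorUnitary : Matrix d d ℂ) *
    (hρ.eigenvectorUnitary : Matrix d d ℂ)) ?_ i
  rw [star_mul, star_star, Matrix.mul_assoc,
    ← Matrix.mul_assoc (hσ.eigenvectorUnitary : Matrix d d ℂ),
    mul_eq_one_comm.1 hσ.star_eigenvectorUnitary_mul_self, Matrix.one_mul,
    hρ.star_eigenvectorUnitary_mul_self]

lemma trace_eq_sum_eigenOverlap_mul (hρ : ρ.IsHermitian) (hσ : σ.IsHermitian) :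
    ρ.trace = ((∑ k, eigenOverlap hρ hσ k * hρ.eigenvalues k.1 : ℝ) : ℂ) := by
  simp only [Fintype.sum_prod_type, ← Finset.sum_mul, sum_eigenOverlap, one_mul,
    hρ.trace_eq_sum_eigenvalues]
  exact (Complex.ofReal_sum _ _).symm

lemma relentR_eq_sum (hρ : ρ.IsHermitian) (hσ : σ.IsHermitian) :
    relentR ρ σ = (∑ k, eigenOverlap hρ hσ k * hρ.eigenvalues k.1 *
      (Real.log (hρ.eigenvalues k.1) - Real.log (hσ.eigenvalues k.2))) / Real.log 2 := by
  have h1 : (ρ * matLog2 ρ).trace =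
      ((∑ i, hρ.eigenvalues i * Real.logb 2 (hρ.eigenvalues i) : ℝ) : ℂ) := by
    rw [matLog2, hermCFC, dif_pos hρ,
      ← trace_conj_diagonal_mul_self hρ.star_eigenvectorUnitary_mul_self]
    congr 2
    exact hρ.eq_eigenvectorUnitary_mul
  have h2 : (ρ * matLog2 σ).trace = ((∑ i, ∑ j, eigenOverlap hρ hσ (i, j) *
      hρ.eigenvalues i * Real.logb 2 (hσ.eigenvalues j) : ℝ) : ℂ) := by
    simp only [eigenOverlap]
    rw [matLog2, hermCFC, dif_pos hσ, ← trace_conj_diagonal_mul]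
    congr 2
    exact hρ.eq_eigenvectorUnitary_mul
  rw [relentR, h1, h2, ← Complex.ofReal_sub, Complex.ofReal_re, Fintype.sum_prod_type,
    Finset.sum_div, ← Finset.sum_sub_distrib]
  refine Finset.sum_congr rfl fun i _ ↦ ?_
  simp only [mul_sub, Finset.sum_sub_distrib, ← Finset.sum_mul, sum_eigenOverlap,
    sub_div, Finset.sum_div, Real.logb, mul_div_assoc, one_mul]

lemma isGreatest_resolventForm (hρ : ρ.PosSemidef) (hσ : σ.PosSemidef) {t : ℝ} (ht : 0 < t) :
    IsGreatest (Set.range (resolventForm ρ σ t)) (∑ k, eigenOverlap hρ.1 hσ.1 k *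
      (hρ.1.eigenvalues k.1 ^ 2 / (hσ.1.eigenvalues k.2 + t * hρ.1.eigenvalues k.1))) := by
  have hU := hρ.1.star_eigenvectorUnitary_mul_self
  have hW := hσ.1.star_eigenvectorUnitary_mul_self
  rw [Fintype.sum_prod_type]
  constructor
  · obtain ⟨X, hX⟩ := exists_resolventForm_eq hU hW hρ.eigenvalues_nonneg
      hσ.eigenvalues_nonneg ht
    rw [← hρ.1.eq_eigenvectorUnitary_mul, ← hσ.1.eq_eigenvectorUnitary_mul] at hX
    exact ⟨X, hX⟩
  · rintro _ ⟨X, rfl⟩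
    have h := resolventForm_le hU hW hρ.eigenvalues_nonneg hσ.eigenvalues_nonneg ht X
    rwa [← hρ.1.eq_eigenvectorUnitary_mul, ← hσ.1.eq_eigenvectorUnitary_mul] at h

/-- Monotonicity of the relative entropy under restriction to a subalgebra: `ρ'` and `σ'` are the
states induced by `ρ` and `σ` through the unital `*`-homomorphism `ι`. -/
theorem relentR_le_of_starHom {e : Type*} [Fintype e] [DecidableEq e] {ρ' σ' : Matrix e e ℂ}
    (hρ : ρ.PosSemidef) (hσ : σ.PosSemidef) (hρ' : ρ'.PosSemidef) (hσ' : σ'.PosSemidef)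
    (hsupp : SupportLE ρ σ) (hsupp' : SupportLE ρ' σ') (ι : Matrix e e ℂ → Matrix d d ℂ)
    (hι_one : ι 1 = 1) (hι_mul : ∀ X Y, ι (X * Y) = ι X * ι Y) (hι_star : ∀ X, ι Xᴴ = (ι X)ᴴ)
    (hιρ : ∀ X, (ι X * ρ).trace = (X * ρ').trace) (hισ : ∀ X, (ι X * σ).trace = (X * σ').trace) :
    relentR ρ' σ' ≤ relentR ρ σ := by
  rw [relentR_eq_sum hρ.1 hσ.1, relentR_eq_sum hρ'.1 hσ'.1]
  refine div_le_div_of_nonneg_right ?_ (Real.log_nonneg one_le_two)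
  have hform (t : ℝ) (X : Matrix e e ℂ) :
      resolventForm ρ' σ' t X = resolventForm ρ σ t (ι X) := by
    simp only [resolventForm, ← hι_star, ← hι_mul, hιρ, hισ]
  refine sum_mul_log_sub_log_le
    (fun k ↦ hρ.eigenvalues_nonneg _) (fun k ↦ hσ.eigenvalues_nonneg _)
    (fun k ↦ hρ'.eigenvalues_nonneg _) (fun k ↦ hσ'.eigenvalues_nonneg _)
    (fun k ↦ hsupp.eigenOverlap_mul_eq_zero hρ.1 hσ.1 k)
    (fun k ↦ hsupp'.eigenOverlap_mul_eq_zero hρ'.1 hσ'.1 k) ?_ fun t ht ↦ ?_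
  · have h := hιρ 1
    rw [hι_one, Matrix.one_mul, Matrix.one_mul, trace_eq_sum_eigenOverlap_mul hρ.1 hσ.1,
      trace_eq_sum_eigenOverlap_mul hρ'.1 hσ'.1, Complex.ofReal_inj] at h
    exact h.symm
  · obtain ⟨X, hX⟩ := (isGreatest_resolventForm hρ' hσ' ht).1
    rw [← hX, hform]
    exact (isGreatest_resolventForm hρ hσ ht).2 ⟨_, rfl⟩

end RelativeEntropy

section FunctionalCalculus

variable {d : Type*} [Fintype d] [DecidableEq d]

lemma hermCFC_conj_diagonal {U A : Matrix d d ℂ} (hU : star U * U = 1) {a : d → ℝ}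
    (hA : A = U * diagonal (fun i ↦ (a i : ℂ)) * star U) (f : ℝ → ℝ) :
    hermCFC f A = U * diagonal (fun i ↦ (f (a i) : ℂ)) * star U := by
  have hH : A.IsHermitian := by
    rw [hA, IsHermitian, ← star_eq_conjTranspose, star_mul, star_mul, star_star, Matrix.mul_assoc]
    congr 2
    rw [star_eq_conjTranspose, diagonal_conjTranspose]
    congr 1
    ext i
    simp
  rw [hermCFC, dif_pos hH]
  have hV := hH.star_eigenvectorUnitary_mul_self
  set V := (hH.eigenvectorUnitary : Matrix d d ℂ) with hVdef
  have hG : diagonal (fun i ↦ (hH.eigenvalues i : ℂ)) * (star V * U) =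
      (star V * U) * diagonal (fun i ↦ (a i : ℂ)) := by
    have h1 : star V * A * U = diagonal (fun i ↦ (hH.eigenvalues i : ℂ)) * (star V * U) := by
      conv_lhs => rw [hH.eq_eigenvectorUnitary_mul, ← hVdef]
      simp only [← Matrix.mul_assoc, hV, Matrix.one_mul]
    have h2 : star V * A * U = (star V * U) * diagonal (fun i ↦ (a i : ℂ)) := by
      conv_lhs => rw [hA]
      simp only [Matrix.mul_assoc, hU, Matrix.mul_one]
    rw [← h1, h2]
  have hGf : diagonal (fun i ↦ (f (hH.eigenvalues i) : ℂ)) * (star V * U) =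
      (star V * U) * diagonal (fun i ↦ (f (a i) : ℂ)) := by
    ext i j
    have h := congrFun (congrFun hG i) j
    rw [diagonal_mul, mul_diagonal, mul_comm, mul_eq_mul_left_iff] at h
    rw [diagonal_mul, mul_diagonal, mul_comm]
    rcases h with h | h
    · rw [Complex.ofReal_inj.1 h]
    · rw [h, zero_mul, zero_mul]
  calc V * diagonal (fun i ↦ (f (hH.eigenvalues i) : ℂ)) * star V
      = V * (diagonal (fun i ↦ (f (hH.eigenvalues i) : ℂ)) * (star V * U)) * star U := by
        simp only [Matrix.mul_assoc, mul_eq_one_comm.1 hU, Matrix.mul_one]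
    _ = _ := by
        rw [hGf]
        simp only [← Matrix.mul_assoc, mul_eq_one_comm.1 hV, Matrix.one_mul]

lemma matLog2_submatrix {A : Matrix d d ℂ} (hA : A.IsHermitian) (e : d ≃ d) :
    matLog2 (A.submatrix e e) = (matLog2 A).submatrix e e := by
  have hU : star ((hA.eigenvectorUnitary : Matrix d d ℂ).submatrix e e) *
      (hA.eigenvectorUnitary : Matrix d d ℂ).submatrix e e = 1 := by
    rw [star_eq_conjTranspose, conjTranspose_submatrix, submatrix_mul_equiv,
      ← star_eq_conjTranspose, Unitary.coe_star_mul_self, submatrix_one_equiv]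
  have hsub (l : d → ℝ) : (hA.eigenvectorUnitary * diagonal (fun i ↦ (l i : ℂ)) *
      star (hA.eigenvectorUnitary : Matrix d d ℂ)).submatrix e e =
      (hA.eigenvectorUnitary : Matrix d d ℂ).submatrix e e *
        diagonal (fun i ↦ (l (e i) : ℂ)) *
        star ((hA.eigenvectorUnitary : Matrix d d ℂ).submatrix e e) := by
    rw [star_eq_conjTranspose, star_eq_conjTranspose, conjTranspose_submatrix,
      ← submatrix_mul_equiv _ _ _ e, ← submatrix_mul_equiv _ _ _ e, submatrix_diagonal_equiv]
    rfl
  rw [matLog2, hermCFC_conj_diagonal hU (a := fun i ↦ hA.eigenvalues (e i)), matLog2, hermCFC,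
    dif_pos hA, hsub]
  conv_lhs => rw [hA.eq_eigenvectorUnitary_mul]
  exact hsub _

omit [DecidableEq d] in
lemma trace_submatrix_equiv (A : Matrix d d ℂ) (e : d ≃ d) :
    (A.submatrix e e).trace = A.trace :=
  Equiv.sum_comp e fun i ↦ A i i

lemma trace_submatrix_mul_matLog2 (A : Matrix d d ℂ) {B : Matrix d d ℂ} (hB : B.IsHermitian)
    {e : d ≃ d} (he : B.submatrix e e = B) :
    (A.submatrix e e * matLog2 B).trace = (A * matLog2 B).trace := by
  conv_lhs => rw [← he]
  rw [matLog2_submatrix hB, submatrix_mul_equiv, trace_submatrix_equiv]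

omit [DecidableEq d] in
lemma SupportLE.submatrix {A B : Matrix d d ℂ} (h : SupportLE A B) (e : d ≃ d) :
    SupportLE (A.submatrix e e) (B.submatrix e e) := by
  intro v hv
  rw [submatrix_mulVec_equiv] at hv ⊢
  have h1 : B *ᵥ (v ∘ e.symm) = 0 := by
    ext i
    simpa using congrFun hv (e.symm i)
  rw [h _ h1]
  rfl

end FunctionalCalculus

section SupportAndMarginals

variable {d : Type*} [Fintype d]

lemma supportLE_smul_add {A B : Matrix d d ℂ} (hA : A.PosSemidef) (hB : B.PosSemidef)
    {a : ℂ} (ha : 0 < a) : SupportLE A (a • A + B) := by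
  intro v hv
  have h1 : a * (star v ⬝ᵥ A *ᵥ v) + star v ⬝ᵥ B *ᵥ v = 0 := by
    rw [← smul_eq_mul, ← dotProduct_smul, ← smul_mulVec, ← dotProduct_add, ← add_mulVec, hv,
      dotProduct_zero]
  have h2 := (add_eq_zero_iff_of_nonneg (mul_nonneg ha.le (hA.dotProduct_mulVec_nonneg v))
    (hB.dotProduct_mulVec_nonneg v)).1 h1
  exact (hA.dotProduct_mulVec_zero_iff v).1 ((mul_eq_zero.1 h2.1).resolve_left ha.ne')

lemma Matrix.PosSemidef.ptrace2 {d₁ d₂ : Type*} [Fintype d₂]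
    {M : Matrix (d₁ × d₂) (d₁ × d₂) ℂ} (hM : M.PosSemidef) : (ptrace2 M).PosSemidef := by
  have h : _root_.ptrace2 M = ∑ k, M.submatrix (fun i ↦ (i, k)) (fun i ↦ (i, k)) := by
    ext i j
    simp [_root_.ptrace2, Matrix.sum_apply]
  rw [h]
  exact posSemidef_sum _ fun k _ ↦ hM.submatrix _

lemma Matrix.PosSemidef.ptrace1 {d₁ d₂ : Type*} [Fintype d₁]
    {M : Matrix (d₁ × d₂) (d₁ × d₂) ℂ} (hM : M.PosSemidef) : (ptrace1 M).PosSemidef := by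
  have h : _root_.ptrace1 M = ∑ k, M.submatrix (fun i ↦ (k, i)) (fun i ↦ (k, i)) := by
    ext i j
    simp [_root_.ptrace1, Matrix.sum_apply]
  rw [h]
  exact posSemidef_sum _ fun k _ ↦ hM.submatrix _

end SupportAndMarginals

section BlockState

lemma sum_mul_prod_erase {ι κ R : Type*} [Fintype ι] [DecidableEq ι] [Fintype κ] [CommSemiring R]
    (j : ι) (u : κ → R) (v : ι → κ → R) :
    ∑ f : ι → κ, u (f j) * ∏ i ∈ Finset.univ.erase j, v i (f i) =
      (∑ q, u q) * ∏ i ∈ Finset.univ.erase j, ∑ q, v i q := by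
  have h {α : Type _} [CommMonoid α] (a : α) (b : ι → α) :
      a * ∏ i ∈ Finset.univ.erase j, b i = ∏ i, if i = j then a else b i := by
    rw [← Finset.mul_prod_erase _ _ (Finset.mem_univ j), if_pos rfl]
    congr 1
    exact Finset.prod_congr rfl fun i hi ↦ (if_neg (Finset.ne_of_mem_erase hi)).symm
  have h2 (i : ι) : (if i = j then ∑ q, u q else ∑ q, v i q) =
      ∑ q, if i = j then u q else v i q := by split_ifs <;> rfl
  rw [h, Finset.prod_congr rfl fun i _ ↦ h2 i, Fintype.prod_sum]
  refine Finset.sum_congr rfl fun f _ ↦ ?_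
  rw [h]
  exact Finset.prod_congr rfl fun i _ ↦ by split_ifs with hi <;> simp [hi]

lemma sum_sum_mul_prod_erase {ι κ R : Type*} [Fintype ι] [DecidableEq ι] [Fintype κ]
    [CommSemiring R] (j : ι) (u : κ → κ → R) (v : ι → κ → κ → R) :
    ∑ f : ι → κ, ∑ g : ι → κ, u (f j) (g j) * ∏ i ∈ Finset.univ.erase j, v i (f i) (g i) =
      (∑ p, ∑ q, u p q) * ∏ i ∈ Finset.univ.erase j, ∑ p, ∑ q, v i p q := by
  simp only [fun f : ι → κ ↦ sum_mul_prod_erase j (u (f j)) (fun i ↦ v i (f i))]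
  exact sum_mul_prod_erase j (fun p ↦ ∑ q, u p q) (fun i p ↦ ∑ q, v i p q)

variable {P Q : Type*} [Fintype Q] [DecidableEq Q] {n : ℕ}

lemma blockState_mul [Fintype P] (A B : Matrix (P × Q) (P × Q) ℂ) (s t : Matrix Q Q ℂ) (j : Fin n) :
    blockState A s n j * blockState B t n j = blockState (A * B) (s * t) n j := by
  ext x y
  simp only [mul_apply, blockState, Fintype.sum_prod_type, Finset.sum_mul]
  refine Finset.sum_congr rfl fun p _ ↦ ?_
  rw [← Finset.sum_mul, ← sum_mul_prod_erase j
    (fun q ↦ A (x.1, x.2 j) (p, q) * B (p, q) (y.1, y.2 j))]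
  refine Finset.sum_congr rfl fun f _ ↦ ?_
  rw [Finset.prod_mul_distrib]
  ring

lemma blockState_conjTranspose (A : Matrix (P × Q) (P × Q) ℂ) (s : Matrix Q Q ℂ) (j : Fin n) :
    blockState Aᴴ sᴴ n j = (blockState A s n j)ᴴ := by
  ext x y
  simp only [blockState, conjTranspose_apply, star_mul', star_prod]

lemma blockState_one [DecidableEq P] (j : Fin n) :
    blockState (1 : Matrix (P × Q) (P × Q) ℂ) 1 n j = 1 := by
  ext x y
  rw [blockState]
  by_cases h : x = y
  · subst h
    simp
  rw [one_apply_ne h]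
  by_cases hj : (x.1, x.2 j) = (y.1, y.2 j)
  · obtain ⟨h1, h2⟩ := Prod.mk.inj hj
    obtain ⟨i, hi⟩ : ∃ i, x.2 i ≠ y.2 i := by
      by_contra! hc
      exact h (Prod.ext h1 (funext hc))
    have hij : i ≠ j := by
      rintro rfl
      exact hi h2
    exact mul_eq_zero_of_right _ (Finset.prod_eq_zero (Finset.mem_erase.2 ⟨hij, Finset.mem_univ i⟩)
      (one_apply_ne hi))
  · rw [one_apply_ne hj, zero_mul]

lemma trace_blockState [Fintype P] (A : Matrix (P × Q) (P × Q) ℂ) {s : Matrix Q Q ℂ}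
    (hs : s.trace = 1) (j : Fin n) : (blockState A s n j).trace = A.trace := by
  simp only [Matrix.trace, diag_apply, blockState, Fintype.sum_prod_type]
  refine Finset.sum_congr rfl fun p _ ↦ ?_
  rw [sum_mul_prod_erase j (fun q ↦ A (p, q) (p, q)) (fun _ q ↦ s q q)]
  simp only [Matrix.trace, diag_apply] at hs
  simp [hs]

lemma ptrace2_blockState (A : Matrix (P × Q) (P × Q) ℂ) {s : Matrix Q Q ℂ} (hs : s.trace = 1)
    (j : Fin n) : ptrace2 (blockState A s n j) = ptrace2 A := by
  ext p p'
  simp only [ptrace2, blockState]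
  rw [sum_mul_prod_erase j (fun q ↦ A (p, q) (p', q)) (fun _ q ↦ s q q)]
  simp only [Matrix.trace, diag_apply] at hs
  simp [hs]

open scoped MatrixOrder in
lemma Matrix.PosSemidef.blockState [Fintype P] {A : Matrix (P × Q) (P × Q) ℂ} {s : Matrix Q Q ℂ}
    (hA : A.PosSemidef) (hs : s.PosSemidef) (j : Fin n) : (blockState A s n j).PosSemidef := by
  obtain ⟨B, rfl⟩ := CStarAlgebra.nonneg_iff_eq_star_mul_self.1 hA.nonneg
  obtain ⟨t, rfl⟩ := CStarAlgebra.nonneg_iff_eq_star_mul_self.1 hs.nonneg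
  rw [star_eq_conjTranspose, star_eq_conjTranspose, ← blockState_mul, blockState_conjTranspose]
  exact posSemidef_conjTranspose_mul_self _

lemma trace_blockState_one_mul_self [Fintype P] (X A : Matrix (P × Q) (P × Q) ℂ) {s : Matrix Q Q ℂ}
    (hs : s.trace = 1) (j : Fin n) :
    (blockState X 1 n j * blockState A s n j).trace = (X * A).trace := by
  rw [blockState_mul, Matrix.one_mul, trace_blockState _ hs]

lemma trace_blockState_one_mul_of_ne [Fintype P] (X A : Matrix (P × Q) (P × Q) ℂ) {s : Matrix Q Q ℂ}
    (hs : s.trace = 1) {j k : Fin n} (hjk : j ≠ k) :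
    (blockState X 1 n j * blockState A s n k).trace = (X * (ptrace2 A ⊗ₖ s)).trace := by
  simp only [Matrix.trace, diag_apply, mul_apply, Fintype.sum_prod_type, kroneckerMap_apply]
  refine Finset.sum_congr rfl fun p _ ↦ ?_
  refine Finset.sum_comm.trans (Eq.trans ?_ Finset.sum_comm)
  refine Finset.sum_congr rfl fun p' _ ↦ ?_
  have hterm (f g : Fin n → Q) :
      blockState X 1 n j (p, f) (p', g) * blockState A s n k (p', g) (p, f) =
      X (p, f j) (p', g j) * s (g j) (f j) * ∏ i ∈ Finset.univ.erase j,
        (1 : Matrix Q Q ℂ) (f i) (g i) *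
          if i = k then A (p', g i) (p, f i) else s (g i) (f i) := by
    have h : blockState A s n k (p', g) (p, f) =
        ∏ i, if i = k then A (p', g i) (p, f i) else s (g i) (f i) := by
      rw [← Finset.mul_prod_erase _ _ (Finset.mem_univ k), if_pos rfl]
      exact congrArg _ (Finset.prod_congr rfl fun i hi ↦
        (if_neg (Finset.ne_of_mem_erase hi)).symm)
    rw [h, ← Finset.mul_prod_erase _ _ (Finset.mem_univ j), if_neg hjk, blockState,
      Finset.prod_mul_distrib]
    ring
  simp only [hterm]
  rw [sum_sum_mul_prod_erase j (fun q q' ↦ X (p, q) (p', q') * s q' q) (fun i q q' ↦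
      (1 : Matrix Q Q ℂ) q q' * if i = k then A (p', q') (p, q) else s q' q),
    Finset.prod_eq_single k, Finset.sum_mul]
  · refine Finset.sum_congr rfl fun q _ ↦ ?_
    rw [Finset.sum_mul]
    refine Finset.sum_congr rfl fun q' _ ↦ ?_
    simp only [one_apply, ptrace2, if_true, ite_mul, one_mul, zero_mul, Finset.sum_ite_eq,
      Finset.mem_univ]
    ring
  · intro i _ hik
    simpa [one_apply, hik, Matrix.trace] using hs
  · intro hk
    simp [hjk.symm] at hk

/-- The permutation of the copies of `Q` as a permutation of the index type. -/
def copyPerm (P Q : Type*) (π : Equiv.Perm (Fin n)) : (P × (Fin n → Q)) ≃ (P × (Fin n → Q)) :=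
  (Equiv.refl P).prodCongr (π.symm.arrowCongr (Equiv.refl Q))

omit [Fintype Q] [DecidableEq Q] in
lemma copyPerm_apply (π : Equiv.Perm (Fin n)) (x : P × (Fin n → Q)) :
    copyPerm P Q π x = (x.1, fun i ↦ x.2 (π i)) := rfl

lemma blockState_submatrix_copyPerm (A : Matrix (P × Q) (P × Q) ℂ) (s : Matrix Q Q ℂ)
    (π : Equiv.Perm (Fin n)) (j : Fin n) :
    (blockState A s n j).submatrix (copyPerm P Q π) (copyPerm P Q π) =
      blockState A s n (π j) := by
  ext x y
  simp only [submatrix_apply, copyPerm_apply, blockState]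
  congr 1
  exact Finset.prod_equiv π (by simp) fun _ _ ↦ rfl

lemma convexSplit_submatrix_copyPerm (A : Matrix (P × Q) (P × Q) ℂ) (s : Matrix Q Q ℂ)
    (π : Equiv.Perm (Fin n)) :
    (convexSplit A s n).submatrix (copyPerm P Q π) (copyPerm P Q π) = convexSplit A s n := by
  conv_rhs => rw [convexSplit, ← Equiv.sum_comp π]
  simp only [← blockState_submatrix_copyPerm]
  ext x y
  simp [convexSplit, Matrix.sum_apply]

omit [Fintype Q] [DecidableEq Q] in
lemma kronecker_ptrace1_submatrix_copyPerm [Fintype P] (B : Matrix P P ℂ)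
    {M : Matrix (P × (Fin n → Q)) (P × (Fin n → Q)) ℂ} {π : Equiv.Perm (Fin n)}
    (hM : M.submatrix (copyPerm P Q π) (copyPerm P Q π) = M) :
    (B ⊗ₖ ptrace1 M).submatrix (copyPerm P Q π) (copyPerm P Q π) = B ⊗ₖ ptrace1 M := by
  ext x y
  simp only [submatrix_apply, copyPerm_apply, kroneckerMap_apply, ptrace1]
  congr 1
  exact Finset.sum_congr rfl fun p _ ↦ congrFun (congrFun hM (p, x.2)) (p, y.2)

end BlockState

/-- Key step of the convex-split lemma: the mutual information of the convex-split
state is bounded by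
D(ρ_{PQₙ} ⊗ σ_{Q₁} ⊗ … ⊗ σ_{Q_{n−1}} ‖ ρ_P ⊗ τ_{Q₁…Qₙ}) − D(ρ_PQ ‖ τ_{PQₙ}),
where τ_{PQₙ} = (1/n)·ρ_PQ + ((n−1)/n)·ρ_P ⊗ σ_Q. -/
theorem convex_split_key_step {P Q : Type} [Fintype P] [Fintype Q]
    [DecidableEq P] [DecidableEq Q] [Nonempty P] [Nonempty Q]
    (n : ℕ) (hn : 1 ≤ n)
    (ρ : Matrix (P × Q) (P × Q) ℂ) (hρ : IsDensityMatrix ρ)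
    (σ : Matrix Q Q ℂ) (hσ : IsDensityMatrix σ)
    (lam : ℝ) (hlam : LoewnerLE ρ (((2 : ℝ) ^ lam) • (ptrace2 ρ ⊗ₖ σ))) :
    mutInfo (convexSplit ρ σ n) ≤
      relent (blockState ρ σ n ⟨n - 1, by omega⟩)
          (ptrace2 ρ ⊗ₖ ptrace1 (convexSplit ρ σ n))
        - relent ρ
            (((n : ℂ)⁻¹) • ρ + (((n : ℂ) - 1) / (n : ℂ)) • (ptrace2 ρ ⊗ₖ σ)) := by
  obtain ⟨m, rfl⟩ : ∃ m, n = m + 1 := ⟨n - 1, by omega⟩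
  have hnC : ((m + 1 : ℕ) : ℂ) ≠ 0 := by exact_mod_cast m.succ_ne_zero
  have hn_pos : (0 : ℂ) < ((m + 1 : ℕ) : ℂ)⁻¹ := by
    rw [inv_pos]
    exact_mod_cast m.succ_pos
  set N : ℂ := ((m + 1 : ℕ) : ℂ) with hN
  set k : Fin (m + 1) := ⟨m + 1 - 1, by omega⟩
  have hcoef : (0 : ℂ) ≤ (N - 1) / N := by
    rw [div_eq_mul_inv]
    refine mul_nonneg ?_ hn_pos.le
    simp [hN]
  set τ := convexSplit ρ σ (m + 1) with hτdef
  set τ' := N⁻¹ • ρ + ((N - 1) / N) • (ptrace2 ρ ⊗ₖ σ) with hτ'def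
  set M := ptrace2 ρ ⊗ₖ ptrace1 τ
  have hblock (j : Fin (m + 1)) : (blockState ρ σ (m + 1) j).PosSemidef := hρ.1.blockState hσ.1 j
  have hprod : (ptrace2 ρ ⊗ₖ σ).PosSemidef := hρ.1.ptrace2.kronecker hσ.1
  have hτ : τ.PosSemidef := (posSemidef_sum _ fun j _ ↦ hblock j).smul hn_pos.le
  have hτ' : τ'.PosSemidef := (hρ.1.smul hn_pos.le).add (hprod.smul hcoef)
  have hMpos : M.PosSemidef := hρ.1.ptrace2.kronecker hτ.ptrace1
  have hsupp' : SupportLE ρ τ' := supportLE_smul_add hρ.1 (hprod.smul hcoef) hn_pos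
  have hsupp : SupportLE (blockState ρ σ (m + 1) k) τ := by
    rw [hτdef, convexSplit, ← Finset.add_sum_erase _ _ (Finset.mem_univ k), smul_add]
    exact supportLE_smul_add (hblock k)
      ((posSemidef_sum _ fun j _ ↦ hblock j).smul hn_pos.le) hn_pos
  have hmono : relentR ρ τ' ≤ relentR (blockState ρ σ (m + 1) k) τ := by
    refine relentR_le_of_starHom (hblock k) hτ hρ.1 hτ' hsupp hsupp'
      (fun X ↦ blockState X 1 (m + 1) k) (blockState_one k)
      (fun X Y ↦ by rw [blockState_mul, Matrix.one_mul])
      (fun X ↦ by rw [← blockState_conjTranspose, conjTranspose_one])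
      (fun X ↦ trace_blockState_one_mul_self X ρ hσ.2 k) fun X ↦ ?_
    rw [hτdef, convexSplit, Matrix.mul_smul, trace_smul, Matrix.mul_sum, trace_sum,
      ← Finset.add_sum_erase _ _ (Finset.mem_univ k), trace_blockState_one_mul_self X ρ hσ.2,
      Finset.sum_congr rfl fun j hj ↦
        trace_blockState_one_mul_of_ne X ρ hσ.2 (Finset.ne_of_mem_erase hj).symm,
      Finset.sum_const, Finset.card_erase_of_mem (Finset.mem_univ k), Finset.card_univ,
      Fintype.card_fin, hτ'def, Matrix.mul_add, trace_add, Matrix.mul_smul, Matrix.mul_smul,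
      trace_smul, trace_smul]
    simp only [smul_eq_mul, nsmul_eq_mul, hN]
    push_cast
    ring
  have hperm (j : Fin (m + 1)) :
      (blockState ρ σ (m + 1) k).submatrix (copyPerm P Q (Equiv.swap k j))
        (copyPerm P Q (Equiv.swap k j)) = blockState ρ σ (m + 1) j := by
    rw [blockState_submatrix_copyPerm, Equiv.swap_apply_left]
  have hτperm (j : Fin (m + 1)) := convexSplit_submatrix_copyPerm ρ σ (Equiv.swap k j)
  have hMperm (j : Fin (m + 1)) := kronecker_ptrace1_submatrix_copyPerm (ptrace2 ρ) (hτperm j)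
  have htrace {B : Matrix (P × (Fin (m + 1) → Q)) (P × (Fin (m + 1) → Q)) ℂ}
      (hB : B.IsHermitian) (hBperm : ∀ j, B.submatrix (copyPerm P Q (Equiv.swap k j))
        (copyPerm P Q (Equiv.swap k j)) = B) :
      (τ * matLog2 B).trace = (blockState ρ σ (m + 1) k * matLog2 B).trace := by
    have h (j : Fin (m + 1)) : (blockState ρ σ (m + 1) j * matLog2 B).trace =
        (blockState ρ σ (m + 1) k * matLog2 B).trace := by
      rw [← hperm j, trace_submatrix_mul_matLog2 _ hB (hBperm j)]
    rw [hτdef, convexSplit, Matrix.smul_mul, trace_smul, Matrix.sum_mul, trace_sum,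
      Finset.sum_congr rfl fun j _ ↦ h j, Finset.sum_const, Finset.card_univ, Fintype.card_fin,
      nsmul_eq_mul, smul_eq_mul, inv_mul_cancel_left₀ hnC]
  have hmarg : ptrace2 τ = ptrace2 ρ := by
    have h : ptrace2 τ = N⁻¹ • ∑ j, ptrace2 (blockState ρ σ (m + 1) j) := by
      ext p p'
      simp only [hτdef, convexSplit, ptrace2, Matrix.smul_apply, Matrix.sum_apply, smul_eq_mul,
        ← Finset.mul_sum]
      rw [Finset.sum_comm]
    rw [h, Finset.sum_congr rfl fun j _ ↦ ptrace2_blockState ρ hσ.2 j, Finset.sum_const,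
      Finset.card_univ, Fintype.card_fin, ← Nat.cast_smul_eq_nsmul ℂ, inv_smul_smul₀ hnC]
  have hI : relentR τ M = relentR (blockState ρ σ (m + 1) k) M -
      relentR (blockState ρ σ (m + 1) k) τ := by
    rw [relentR, relentR, relentR, htrace hτ.1 hτperm, htrace hMpos.1 hMperm, ← Complex.sub_re]
    congr 1
    ring
  rw [mutInfo, hmarg, relent, relent, relent, if_pos hsupp']
  by_cases hc : SupportLE (blockState ρ σ (m + 1) k) M
  · have hτM : SupportLE τ M := by
      intro v hv
      rw [hτdef, convexSplit, smul_mulVec, sum_mulVec, Finset.sum_eq_zero, smul_zero]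
      intro j _
      rw [← hperm j]
      refine hc.submatrix _ v ?_
      rwa [hMperm j]
    rw [if_pos hc, if_pos hτM, ← EReal.coe_sub, EReal.coe_le_coe_iff, hI]
    exact sub_le_sub_left hmono _
  · rw [if_neg hc, EReal.top_sub_coe]
    exact le_top

end
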